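/- arXiv:1606.07844 — 3 statements merged into one kernel-verified Lean document; each statement's English description precedes it below -/
import Mathlib

section
/- Let m and n be positive integers with m ∣ n, and let χ be a nontrivial Dirichlet character modulo m with values in ℂ. Then ∑_{a=0}^{n-1} χ(a) · (a/n) = ∑_{s=0}^{m-1} χ(s) · (s/m), where in the left-hand sum χ is evaluated at the residue of a modulo m. -/
theorem aux_sum_zero (m : ℕ) (hm : 0 < m)
    (χ : DirichletCharacter ℂ m) (hχ : χ ≠ 1) :
    ∑ a ∈ Finset.range m, χ (a : ZMod m) = 0 := by
  haveI : NeZero m := ⟨hm.ne'⟩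
  rw [← MulChar.sum_eq_zero_of_ne_one hχ]
  refine Finset.sum_bij' (fun a _ => (a : ZMod m)) (fun b _ => b.val) ?_ ?_ ?_ ?_ ?_
  · intros; simp
  · intro b _; simpa using ZMod.val_lt b
  · intro a ha; exact ZMod.val_cast_of_lt (by simpa using ha)
  · intro b _; simp
  · intros; rfl

theorem aux_sum_mul (m : ℕ) (hm : 0 < m)
    (χ : DirichletCharacter ℂ m) (hχ : χ ≠ 1) (k : ℕ) :
    ∑ a ∈ Finset.range (m * k), χ (a : ZMod m) * (a : ℂ) =
      k * ∑ s ∈ Finset.range m, χ (s : ZMod m) * (s : ℂ) := by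
  induction k with
  | zero => simp
  | succ k ih =>
    rw [Nat.mul_succ, Finset.sum_range_add, ih]
    have h : ∀ x : ℕ, χ ((m * k + x : ℕ) : ZMod m) * ((m * k + x : ℕ) : ℂ) =
        (m * k : ℂ) * χ (x : ZMod m) + χ (x : ZMod m) * (x : ℂ) := by
      intro x
      have : ((m * k + x : ℕ) : ZMod m) = (x : ZMod m) := by simp
      rw [this]; push_cast; ring
    simp only [h]
    rw [Finset.sum_add_distrib, ← Finset.mul_sum, aux_sum_zero m hm χ hχ]
    push_cast; ring

/-- Let `m ∣ n` be positive integers and `χ` a nontrivial Dirichlet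
character modulo `m` with values in `ℂ`. Then
`∑_{a=0}^{n-1} χ(a) ⬝ (a/n) = ∑_{s=0}^{m-1} χ(s) ⬝ (s/m)`. -/
theorem sum_dirichlet_frac_eq (m n : ℕ) (hm : 0 < m) (hn : 0 < n) (hdvd : m ∣ n)
    (χ : DirichletCharacter ℂ m) (hχ : χ ≠ 1) :
    ∑ a ∈ Finset.range n, χ (a : ZMod m) * ((a : ℂ) / (n : ℂ)) =
      ∑ s ∈ Finset.range m, χ (s : ZMod m) * ((s : ℂ) / (m : ℂ)) := by
  obtain ⟨k, rfl⟩ := hdvd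
  have hk : (k : ℂ) ≠ 0 := by
    rintro h
    have : k = 0 := by exact_mod_cast h
    simp [this] at hn
  have hm' : (m : ℂ) ≠ 0 := by exact_mod_cast hm.ne'
  simp only [← mul_div_assoc]
  rw [← Finset.sum_div, ← Finset.sum_div, aux_sum_mul m hm χ hχ k]
  push_cast
  field_simp
end

section
/- Let p be an odd prime and r ≥ 1 an integer. Then ∑_{x=0}^{p^r − 1} {x²/p^r} = (1/2)(p^r − p^⌊r/2⌋) − ((p^⌊(r+1)/2⌋ − 1)/(p − 1)) · h_p^*, where h_p^* := −∑_{a=0}^{p−1} (a|p) · (a/p). -/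
/-- `h_p^* = -∑_{a=0}^{p-1} (a|p)·(a/p)`, where `(a|p)` is the Legendre symbol. -/
def hpStar (p : ℕ) [Fact p.Prime] : ℚ :=
  -∑ a ∈ Finset.range p, (legendreSym p a : ℚ) * ((a : ℚ) / p)

namespace FractSq

open Finset

/-- summand -/
def F (p r x : ℕ) : ℚ := Int.fract ((x : ℚ) ^ 2 / (p : ℚ) ^ r)

lemma F_eq (p r x : ℕ) : F p r x = ((x ^ 2 % p ^ r : ℕ) : ℚ) / (p : ℚ) ^ r := by
  have := Int.fract_div_natCast_eq_div_natCast_mod (k := ℚ) (m := x ^ 2) (n := p ^ r)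
  unfold F
  push_cast at this ⊢
  exact this

lemma sum_range_mul' (f : ℕ → ℚ) (a b : ℕ) :
    ∑ x ∈ range (a * b), f x = ∑ t ∈ range b, ∑ i ∈ range a, f (i + a * t) := by
  induction b with
  | zero => simp
  | succ b ih =>
    rw [Nat.mul_succ, Finset.sum_range_add, ih, Finset.sum_range_succ]
    simp [add_comm]

lemma sum_range_zmod (p : ℕ) [NeZero p] (f : ℕ → ℚ) :
    ∑ x ∈ range p, f x = ∑ x : ZMod p, f x.val := by
  refine Finset.sum_bij' (fun x _ => (x : ZMod p)) (fun x _ => x.val) ?_ ?_ ?_ ?_ ?_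
  · simp
  · intro a _; simpa using ZMod.val_lt a
  · intro a ha; exact ZMod.val_cast_of_lt (by simpa using ha)
  · intro a _; simp
  · intro a ha; rw [ZMod.val_cast_of_lt (by simpa using ha)]

lemma sum_id (p : ℕ) : ∑ x ∈ range p, (x : ℚ) = p * (p - 1) / 2 := by
  induction p with
  | zero => simp
  | succ n ih => rw [sum_range_succ, ih]; push_cast; ring

lemma S_one (p : ℕ) [Fact p.Prime] (hodd : Odd p) :
    ∑ x ∈ range p, F p 1 x = ((p : ℚ) - 1) / 2 - hpStar p := by
  have hp0 : (p : ℚ) ≠ 0 := by exact_mod_cast (Fact.out : p.Prime).ne_zero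
  have hp2 : p ≠ 2 := by rintro rfl; exact absurd hodd (by decide)
  have h1 : ∀ x : ZMod p, F p 1 x.val = ((x ^ 2).val : ℚ) / p := by
    intro x
    rw [F_eq, pow_one, pow_one, ← ZMod.val_natCast]
    simp
  rw [sum_range_zmod]
  simp_rw [h1]
  rw [← Finset.sum_fiberwise (s := univ) (g := fun x : ZMod p => x ^ 2)]
  have h2 : ∀ a : ZMod p, ∑ x ∈ univ.filter (fun x : ZMod p => x ^ 2 = a), ((x ^ 2).val : ℚ) / p
      = ((legendreSym p a.val : ℚ) + 1) * ((a.val : ℚ) / p) := by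
    intro a
    have h3 : ∀ x ∈ univ.filter (fun x : ZMod p => x ^ 2 = a), ((x ^ 2).val : ℚ) / p
        = (a.val : ℚ) / p := by
      intro x hx
      rw [(mem_filter.1 hx).2]
    rw [sum_congr rfl h3, sum_const, nsmul_eq_mul]
    have := legendreSym.card_sqrts p hp2 a.val
    congr 1
    rw [show (legendreSym p a.val : ℚ) + 1 = ((legendreSym p a.val + 1 : ℤ) : ℚ) by push_cast; rfl,
      ← this]
    simp only [Int.cast_natCast, Nat.cast_inj]
    congr 1
    ext x
    simp
  simp_rw [h2]
  rw [← sum_range_zmod p (fun n => ((legendreSym p n : ℚ) + 1) * ((n : ℚ) / p))]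
  simp_rw [add_mul, one_mul]
  rw [sum_add_distrib, ← sum_div, sum_id, hpStar]
  field_simp
  ring

/-- sum over units -/
def U (p r : ℕ) : ℚ := ∑ x ∈ range (p ^ r), if p ∣ x then 0 else F p r x

/-- number of units -/
def N (p r : ℕ) : ℚ := ∑ x ∈ range (p ^ r), if p ∣ x then 0 else 1

lemma dvd_iff' (p r i t : ℕ) : p ∣ i + p ^ (r + 1) * t ↔ p ∣ i :=
  (Nat.dvd_add_left (Dvd.dvd.mul_right (dvd_pow_self p (by simp)) t))

lemma N_eq (p r : ℕ) [Fact p.Prime] : N p (r + 1) = p ^ r * (p - 1) := by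
  induction r with
  | zero =>
    have hp := (Fact.out : p.Prime)
    obtain ⟨n, rfl⟩ : ∃ n, p = n + 1 := ⟨p - 1, by have := hp.pos; omega⟩
    unfold N
    rw [zero_add, pow_one, sum_range_succ']
    have : ∀ k ∈ range n, (if n + 1 ∣ k + 1 then (0 : ℚ) else 1) = 1 := by
      intro k hk
      rw [if_neg]
      intro h
      have := Nat.le_of_dvd (by omega) h
      have := mem_range.1 hk
      omega
    rw [sum_congr rfl this]
    simp
  | succ r ih =>
    unfold N at ih ⊢
    rw [pow_succ p (r + 1), sum_range_mul']
    simp_rw [dvd_iff']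
    rw [ih]
    simp
    ring

lemma inner (p r i : ℕ) [Fact p.Prime] (hodd : Odd p) (hi : ¬ p ∣ i) :
    ∑ t ∈ range p, F p (r + 2) (i + p ^ (r + 1) * t) = F p (r + 1) i + (p - 1) / 2 := by
  have hp := (Fact.out : p.Prime)
  have hp0 : (p : ℚ) ≠ 0 := by exact_mod_cast hp.ne_zero
  set P := p ^ (r + 1) with hP
  have hPpos : 0 < P := pow_pos hp.pos _
  set q := i ^ 2 / P with hq
  set g : ℕ → ℕ := fun t => (q + 2 * i * t + P * t ^ 2) % p with hg
  have hexp : ∀ t, (i + P * t) ^ 2 = i ^ 2 + P * (2 * i * t + P * t ^ 2) := by intro t; ring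
  have h1 : ∀ t, F p (r + 2) (i + P * t) = F p (r + 1) i / p + (g t : ℚ) / p := by
    intro t
    rw [F_eq, F_eq, pow_succ p (r + 1), ← hP, Nat.mod_mul, hexp, Nat.add_mul_mod_self_left,
      Nat.add_mul_div_left _ _ hPpos, ← hq, ← add_assoc]
    have : (p : ℚ) ^ (r + 1) = (P : ℚ) := by rw [hP]; push_cast; rfl
    rw [pow_succ (p : ℚ) (r + 1), this]
    have : (P : ℚ) ≠ 0 := by exact_mod_cast hPpos.ne'
    simp only [hg]
    push_cast
    field_simp
  simp_rw [h1]
  rw [sum_add_distrib, ← sum_div]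
  have hinj : Set.InjOn g (range p : Set ℕ) := by
    intro s hs t ht hst
    simp only [hg] at hst
    have hst' := (ZMod.natCast_eq_natCast_iff' _ _ p).2 hst
    have hPz : (P : ZMod p) = 0 := by rw [hP]; simp
    push_cast at hst'
    rw [hPz] at hst'
    have h2i : (2 * i : ZMod p) ≠ 0 := by
      have : ((2 * i : ℕ) : ZMod p) ≠ 0 := by
        rw [Ne, ZMod.natCast_eq_zero_iff, hp.dvd_mul]
        rintro (h | h)
        · have := (Nat.prime_dvd_prime_iff_eq hp Nat.prime_two).1 h
          subst this
          exact absurd hodd (by decide)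
        · exact hi h
      exact_mod_cast this
    have h3 : (s : ZMod p) = t := by
      apply mul_left_cancel₀ h2i
      simpa using hst'
    have := (ZMod.natCast_eq_natCast_iff' _ _ p).1 h3
    rwa [Nat.mod_eq_of_lt (by simpa using hs), Nat.mod_eq_of_lt (by simpa using ht)] at this
  have himg : (range p).image g = range p := by
    apply eq_of_subset_of_card_le
    · intro y hy
      obtain ⟨t, _, rfl⟩ := mem_image.1 hy
      exact mem_range.2 (Nat.mod_lt _ hp.pos)
    · rw [card_image_of_injOn hinj]
  have hs : ∑ t ∈ range p, (g t : ℚ) = ∑ y ∈ range p, (y : ℚ) := by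
    conv_rhs => rw [← himg]
    rw [sum_image hinj]
  rw [← sum_div, hs, sum_id, sum_const, card_range, nsmul_eq_mul]
  field_simp

lemma U_eq (p r : ℕ) [Fact p.Prime] (hodd : Odd p) :
    U p (r + 1) = p ^ r * (p - 1) / 2 - hpStar p := by
  induction r with
  | zero =>
    have := S_one p hodd
    unfold U
    rw [zero_add, pow_one, pow_zero, one_mul, ← this]
    refine sum_congr rfl fun x hx => ?_
    split_ifs with h
    · rw [Nat.eq_zero_of_dvd_of_lt h (mem_range.1 hx)]
      simp [F]
    · rfl
  | succ r ih =>
    have hN := N_eq p r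
    unfold U N at *
    rw [pow_succ p (r + 1), sum_range_mul', sum_comm]
    simp_rw [dvd_iff']
    have : ∀ i ∈ range (p ^ (r + 1)),
        ∑ t ∈ range p, (if p ∣ i then 0 else F p (r + 1 + 1) (i + p ^ (r + 1) * t))
        = (if p ∣ i then 0 else F p (r + 1) i) + (if p ∣ i then 0 else 1) * ((p - 1) / 2 : ℚ) := by
      intro i _
      split_ifs with h
      · simp
      · rw [inner p r i hodd h]; ring
    rw [sum_congr rfl this, sum_add_distrib, ← sum_mul, ih, hN]
    ring

/-- full sum -/
def S (p r : ℕ) : ℚ := ∑ x ∈ range (p ^ r), F p r x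

lemma S_rec (p r : ℕ) [Fact p.Prime] : S p (r + 2) = U p (r + 2) + p * S p r := by
  have hp := (Fact.out : p.Prime)
  have hp0 : (p : ℚ) ≠ 0 := by exact_mod_cast hp.ne_zero
  have h1 : S p (r + 2) = U p (r + 2)
      + ∑ x ∈ range (p ^ (r + 2)), if p ∣ x then F p (r + 2) x else 0 := by
    unfold S U
    rw [← sum_add_distrib]
    refine sum_congr rfl fun x _ => ?_
    split_ifs <;> simp
  rw [h1]
  congr 1
  rw [show p ^ (r + 2) = p * (p ^ r * p) by ring, sum_range_mul']
  have h2 : ∀ t, ∑ i ∈ range p, (if p ∣ i + p * t then F p (r + 2) (i + p * t) else 0)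
      = F p r t := by
    intro t
    rw [sum_eq_single 0]
    · rw [if_pos (by simp), zero_add]
      unfold F
      congr 1
      push_cast
      field_simp
      ring
    · intro i hi hne
      rw [if_neg]
      intro h
      rw [Nat.dvd_add_left (dvd_mul_right p t)] at h
      exact hne (Nat.eq_zero_of_dvd_of_lt h (mem_range.1 hi))
    · intro h
      exact absurd (mem_range.2 hp.pos) h
  simp_rw [h2]
  rw [sum_range_mul']
  have h3 : ∀ i t, F p r (i + p ^ r * t) = F p r i := by
    intro i t
    rw [F_eq, F_eq, show (i + p ^ r * t) ^ 2 = i ^ 2 + p ^ r * (2 * i * t + p ^ r * t ^ 2) by ring,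
      Nat.add_mul_mod_self_left]
  simp_rw [h3]
  simp [S]

lemma S_eq (p : ℕ) [Fact p.Prime] (hodd : Odd p) : ∀ r : ℕ, S p r =
    (1 / 2) * ((p : ℚ) ^ r - (p : ℚ) ^ (r / 2)) -
        (((p : ℚ) ^ ((r + 1) / 2) - 1) / ((p : ℚ) - 1)) * hpStar p
  | 0 => by simp [S, F]
  | 1 => by
    have hp1 : (p : ℚ) - 1 ≠ 0 := by
      rw [sub_ne_zero]; exact_mod_cast (Fact.out : p.Prime).ne_one
    have := S_one p hodd
    unfold S
    rw [pow_one, this]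
    norm_num
    field_simp
  | r + 2 => by
    have hp1 : (p : ℚ) - 1 ≠ 0 := by
      rw [sub_ne_zero]; exact_mod_cast (Fact.out : p.Prime).ne_one
    rw [S_rec, U_eq p (r + 1) hodd, S_eq p hodd r, show (r + 2) / 2 = r / 2 + 1 by omega,
      show (r + 2 + 1) / 2 = (r + 1) / 2 + 1 by omega]
    field_simp
    ring

end FractSq

/-- For `p` an odd prime and `r ≥ 1`,
`∑_{x=0}^{p^r-1} {x²/p^r} = (1/2)(p^r - p^⌊r/2⌋) - ((p^⌊(r+1)/2⌋ - 1)/(p-1))·h_p^*`. -/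
theorem sum_fract_sq_div_prime_pow (p : ℕ) [Fact p.Prime] (hodd : Odd p) (r : ℕ) (hr : 1 ≤ r) :
    ∑ x ∈ Finset.range (p ^ r), Int.fract ((x : ℚ) ^ 2 / (p : ℚ) ^ r) =
      (1 / 2) * ((p : ℚ) ^ r - (p : ℚ) ^ (r / 2)) -
        (((p : ℚ) ^ ((r + 1) / 2) - 1) / ((p : ℚ) - 1)) * hpStar p := by
  exact FractSq.S_eq p hodd r
end

section
/- Let p be an odd prime and r ≥ 1 an integer. Then ∑_{0 < x < 2p^r, x odd} {x²/(4p^r)} = (1/2)(p^r − p^⌊r/2⌋) + {p^r/4} · p^⌊r/2⌋ − ((p^⌊(r+1)/2⌋ − 1)/(2(p − 1))) · ( (1/2)(1 − (−1)^{(p−1)/2}) + (1 − (2|p)) · h_p^* + h_p' ), where h_p^* := −∑_{a=0}^{p−1} (a|p) · (a/p) and h_p' := −∑_{0 < a < 4p, a odd} (−1)^{(a−1)/2} (a|p) · (a/(4p)). -/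
/-- `h_p' = -∑_{0<a<4p, a odd} (-1)^((a-1)/2)·(a|p)·(a/(4p))`. -/
def hpPrime (p : ℕ) [Fact p.Prime] : ℚ :=
  -∑ a ∈ (Finset.range (4 * p)).filter (fun a => Odd a),
      (-1 : ℚ) ^ ((a - 1) / 2) * (legendreSym p a : ℚ) * ((a : ℚ) / (4 * p))

section aux

open Finset


lemma sum_range_mul_aux (f : ℕ → ℚ) (n m : ℕ) :
    ∑ x ∈ range (n * m), f x = ∑ j ∈ range m, ∑ i ∈ range n, f (i + n * j) := by
  induction m with
  | zero => simp
  | succ m ih =>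
    rw [Nat.mul_succ, sum_range_add, ih, sum_range_succ]
    congr 1
    exact sum_congr rfl fun i _ => by rw [add_comm]

lemma sum_mod_perm (p : ℕ) [Fact p.Prime] (x n : ℕ) (hx : ¬ p ∣ x) (g : ℕ → ℚ) :
    ∑ j ∈ range p, g ((n + x * j) % p) = ∑ j ∈ range p, g j := by
  have hp : 0 < p := (Fact.out : p.Prime).pos
  have hmaps : ∀ j ∈ range p, (n + x * j) % p ∈ range p := fun j _ => by
    simpa using Nat.mod_lt _ hp
  have hinj : Set.InjOn (fun j => (n + x * j) % p) (range p : Set ℕ) := by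
    intro a ha b hb hab
    simp only [coe_range, Set.mem_Iio] at ha hb
    have h1 : n + x * a ≡ n + x * b [MOD p] := hab
    have h2 := Nat.ModEq.add_left_cancel' n h1
    have h3 : a ≡ b [MOD p] := Nat.ModEq.cancel_left_of_coprime
      ((Nat.Prime.coprime_iff_not_dvd Fact.out).2 hx) h2
    exact Nat.ModEq.eq_of_lt_of_lt h3 ha hb
  have him : (range p).image (fun j => (n + x * j) % p) = range p :=
    eq_of_subset_of_card_le (image_subset_iff.2 hmaps) (by rw [card_image_of_injOn hinj])
  conv_rhs => rw [← him]
  rw [sum_image hinj]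

lemma fract_nat_div (a b : ℕ) : Int.fract ((a : ℚ) / b) = ((a % b : ℕ) : ℚ) / b := by
  exact Int.fract_div_natCast_eq_div_natCast_mod

lemma sum_range_q (p : ℕ) : ∑ j ∈ range p, (j : ℚ) = p * (p - 1) / 2 := by
  induction p with
  | zero => simp
  | succ p ih => rw [sum_range_succ, ih]; push_cast; ring

lemma hermite_aux (p : ℕ) [Fact p.Prime] (x q : ℕ) (hx : ¬ p ∣ x) (hq : p ∣ q) (hq0 : 0 < q) :
    ∑ j ∈ range p, Int.fract (((x + 2 * q * j : ℕ) : ℚ) ^ 2 / (4 * ((q * p : ℕ) : ℚ))) =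
      Int.fract ((x : ℚ) ^ 2 / (4 * (q : ℚ))) + ((p : ℚ) - 1) / 2 := by
  have hp : 0 < p := (Fact.out : p.Prime).pos
  obtain ⟨c, hc⟩ := hq
  have h4 : 0 < 4 * q := by omega
  have hterm : ∀ j, Int.fract (((x + 2 * q * j : ℕ) : ℚ) ^ 2 / (4 * ((q * p : ℕ) : ℚ))) =
      (((x ^ 2 % (4 * q) : ℕ) : ℚ) + (4 * q) * (((x ^ 2 / (4 * q) + x * j) % p : ℕ) : ℚ))
        / (4 * q * p) := by
    intro j
    have e1 : (x + 2 * q * j) ^ 2 = x ^ 2 + (4 * q) * (x * j + p * (c * j ^ 2)) := by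
      have : (x + 2 * q * j) ^ 2 = x ^ 2 + (4 * q) * (x * j + q * j ^ 2) := by ring
      rw [this]; nth_rewrite 2 [hc]; ring
    have e2 : (((x + 2 * q * j : ℕ) : ℚ) ^ 2 / (4 * ((q * p : ℕ) : ℚ))) =
        (((x + 2 * q * j) ^ 2 : ℕ) : ℚ) / ((4 * q * p : ℕ) : ℚ) := by
      push_cast; ring
    rw [e2, fract_nat_div, Nat.mod_mul, e1, Nat.add_mul_mod_self_left,
      Nat.add_mul_div_left _ _ h4, ← add_assoc, Nat.add_mul_mod_self_left]
    push_cast; ring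
  rw [sum_congr rfl fun j _ => hterm j, ← sum_div, sum_add_distrib, ← mul_sum,
    sum_mod_perm p x _ hx (fun j => (j : ℚ)), sum_range_q]
  have e3 : ((x : ℚ) ^ 2 / (4 * (q : ℚ))) = ((x ^ 2 : ℕ) : ℚ) / ((4 * q : ℕ) : ℚ) := by
    push_cast; ring
  rw [e3, fract_nat_div]
  have : (q : ℚ) ≠ 0 := by positivity
  have : (p : ℚ) ≠ 0 := by positivity
  simp only [sum_const, card_range, nsmul_eq_mul]
  push_cast
  field_simp

lemma sum_dvd_aux (p N : ℕ) (hp : 0 < p) (g : ℕ → ℚ) :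
    ∑ x ∈ range (p * N), (if p ∣ x then g x else 0) = ∑ z ∈ range N, g (p * z) := by
  rw [sum_range_mul_aux]
  refine sum_congr rfl fun j _ => ?_
  rw [sum_eq_single_of_mem 0 (by simpa using hp)]
  · simp
  · intro i hi h0
    rw [if_neg]
    rw [(Nat.dvd_add_left (dvd_mul_right p j))]
    intro h
    exact h0 (Nat.eq_zero_of_dvd_of_lt h (by simpa using hi))

/-- summand -/
def gG (q x : ℕ) : ℚ := if Odd x then Int.fract ((x : ℚ) ^ 2 / (4 * (q : ℚ))) else 0
/-- full sum -/
def sS (q : ℕ) : ℚ := ∑ x ∈ range (2 * q), gG q x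
/-- unit sum -/
def uU (p q : ℕ) : ℚ := ∑ x ∈ range (2 * q), if p ∣ x then 0 else gG q x

lemma count_odd (q : ℕ) : ∑ x ∈ range (2 * q), (if Odd x then (1 : ℚ) else 0) = q := by
  rw [sum_range_mul_aux]
  have h2 : ∀ j ∈ range q, ∑ i ∈ range 2, (if Odd (i + 2 * j) then (1 : ℚ) else 0) = 1 := by
    intro j _
    rw [sum_range_succ, sum_range_one]
    simp [Nat.odd_add]
  rw [sum_congr rfl h2]; simp

lemma count_unit (p m : ℕ) (hp : Odd p) :
    ∑ x ∈ range (2 * (m * p)), (if p ∣ x then (0 : ℚ) else if Odd x then 1 else 0) =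
      (m * p : ℚ) - m := by
  have h1 := sum_dvd_aux p (2 * m) hp.pos (fun x => if Odd x then (1 : ℚ) else 0)
  have h2 := count_odd (m * p)
  have h3 := count_odd m
  simp only [Nat.odd_mul, hp, true_and] at h1
  rw [h3, show p * (2 * m) = 2 * (m * p) by ring] at h1
  push_cast at h2
  rw [← h2, ← h1, ← sum_sub_distrib]
  refine sum_congr rfl fun x _ => ?_
  split_ifs <;> simp

lemma sS_split (p m : ℕ) (hp : 0 < p) :
    sS (m * p) = uU p (m * p) + ∑ z ∈ range (2 * m), gG (m * p) (p * z) := by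
  rw [← sum_dvd_aux p (2 * m) hp, show p * (2 * m) = 2 * (m * p) by ring, sS, uU,
    ← sum_add_distrib]
  refine sum_congr rfl fun x _ => ?_
  split_ifs <;> simp

lemma uU_step (p q m : ℕ) [Fact p.Prime] (hodd : Odd p) (hq : q = m * p) (hm : 0 < m) :
    uU p (q * p) = uU p q + ((p : ℚ) - 1) / 2 * (q - m) := by
  have hc := count_unit p m hodd
  rw [← hq] at hc
  have hq0 : 0 < q := by rw [hq]; exact Nat.mul_pos hm hodd.pos
  have hqc : (q : ℚ) = m * p := by rw [hq]; push_cast; ring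
  rw [hqc, ← hc, uU, uU, mul_sum, ← sum_add_distrib, show 2 * (q * p) = (2 * q) * p by ring,
    sum_range_mul_aux, sum_comm]
  refine sum_congr rfl fun x _ => ?_
  have hd : ∀ j, p ∣ x + 2 * q * j ↔ p ∣ x := fun j =>
    Nat.dvd_add_left ⟨2 * m * j, by rw [hq]; ring⟩
  have ho : ∀ j, Odd (x + 2 * q * j) ↔ Odd x := fun j => by
    simp [Nat.odd_add]
  simp only [gG, hd, ho]
  split_ifs with h1 h2
  · simp
  · rw [hermite_aux p x q h1 ⟨m, by rw [hq]; ring⟩ hq0]; ring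
  · simp

lemma uU_pow (p s : ℕ) [Fact p.Prime] (hodd : Odd p) :
    uU p (p ^ (s + 1)) = uU p p + ((p : ℚ) - 1) / 2 * ((p : ℚ) ^ s - 1) := by
  induction s with
  | zero => simp
  | succ s ih =>
    rw [pow_succ p (s + 1), uU_step p (p ^ (s + 1)) (p ^ s) hodd (pow_succ p s)
      (pow_pos hodd.pos _), ih]
    push_cast; ring

lemma sS_step (p q : ℕ) [Fact p.Prime] (hodd : Odd p) (hq : 0 < q) :
    sS (q * p * p) = uU p (q * p * p) + p * sS q := by
  rw [sS_split p (q * p) hodd.pos]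
  congr 1
  rw [show 2 * (q * p) = (2 * q) * p by ring, sum_range_mul_aux]
  have hp0 : (p : ℚ) ≠ 0 := by exact_mod_cast hodd.pos.ne'
  have hq0 : (q : ℚ) ≠ 0 := by exact_mod_cast hq.ne'
  have : ∀ j ∈ range p, ∑ i ∈ range (2 * q), gG (q * p * p) (p * (i + 2 * q * j)) = sS q := by
    intro j _
    refine sum_congr rfl fun i _ => ?_
    have ho : Odd (p * (i + 2 * q * j)) ↔ Odd i := by
      simp [Nat.odd_mul, Nat.odd_add, hodd]
    simp only [gG, ho]
    split_ifs
    · have : (((p * (i + 2 * q * j) : ℕ) : ℚ) ^ 2 / (4 * ((q * p * p : ℕ) : ℚ))) =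
        (i : ℚ) ^ 2 / (4 * (q : ℚ)) + ((i * j + q * j ^ 2 : ℕ) : ℚ) := by
        push_cast; field_simp; ring
      rw [this, Int.fract_add_natCast]
    · rfl
  rw [sum_congr rfl this]; simp

lemma sS_p (p : ℕ) [Fact p.Prime] (hodd : Odd p) :
    sS p = uU p p + Int.fract ((p : ℚ) / 4) := by
  have h := sS_split p 1 hodd.pos
  have hp0 : (p : ℚ) ≠ 0 := by exact_mod_cast hodd.pos.ne'
  rw [one_mul] at h
  rw [h]
  simp [sum_range_succ, gG, hodd]
  congr 1
  field_simp

lemma sum_range_zmod (p : ℕ) [Fact p.Prime] (f : ZMod p → ℚ) :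
    ∑ x ∈ range p, f (x : ZMod p) = ∑ y : ZMod p, f y := by
  refine sum_bij' (fun x _ => (x : ZMod p)) (fun y _ => y.val) ?_ ?_ ?_ ?_ ?_
  · simp
  · intro y _; simpa using ZMod.val_lt y
  · intro x hx; simpa using ZMod.val_cast_of_lt (by simpa using hx)
  · simp
  · simp

lemma two_ne_zmod (p : ℕ) [Fact p.Prime] (hodd : Odd p) : (2 : ZMod p) ≠ 0 := by
  intro h
  have : ((2 : ℕ) : ZMod p) = 0 := by exact_mod_cast h
  rw [ZMod.natCast_eq_zero_iff] at this
  have h2 := (Nat.prime_dvd_prime_iff_eq Fact.out Nat.prime_two).1 this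
  subst h2
  exact absurd hodd (by decide)

lemma sum_odd_zmod (p : ℕ) [Fact p.Prime] (hodd : Odd p) (f : ZMod p → ℚ) :
    ∑ x ∈ range (2 * p), (if Odd x then f (x : ZMod p) else 0) = ∑ y : ZMod p, f y := by
  rw [sum_range_mul_aux]
  have h2 : ∀ j ∈ range p, ∑ i ∈ range 2, (if Odd (i + 2 * j) then
      f ((i + 2 * j : ℕ) : ZMod p) else 0) = (fun y : ZMod p => f (1 + 2 * y)) j := by
    intro j _
    rw [sum_range_succ, sum_range_one]
    simp [Nat.odd_add]
  rw [sum_congr rfl h2]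
  refine (sum_range_zmod p (fun y : ZMod p => f (1 + 2 * y))).trans ?_
  have hb : Function.Bijective (fun y : ZMod p => 1 + 2 * y) := by
    rw [← Finite.injective_iff_bijective]
    intro a b hab
    exact mul_left_cancel₀ (two_ne_zmod p hodd) (add_left_cancel hab)
  exact hb.sum_comp f

lemma four_inj (p : ℕ) [Fact p.Prime] (hodd : Odd p) (a b : ℕ) (ha : a < p) (hb : b < p)
    (h : ((4 * a + 1 : ℕ) : ZMod p) = ((4 * b + 1 : ℕ) : ZMod p)) : a = b := by
  push_cast at h
  have h4 : (4 : ZMod p) ≠ 0 := by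
    rw [show (4 : ZMod p) = 2 * 2 by norm_num]
    exact mul_ne_zero (two_ne_zmod p hodd) (two_ne_zmod p hodd)
  have h1 := mul_left_cancel₀ h4 (add_right_cancel h)
  rw [ZMod.natCast_eq_natCast_iff] at h1
  exact Nat.ModEq.eq_of_lt_of_lt h1 ha hb

lemma fract_odd (p : ℕ) [Fact p.Prime] (hodd : Odd p) (x : ℕ) (hx : Odd x) :
    Int.fract ((x : ℚ) ^ 2 / (4 * (p : ℚ))) =
      ∑ k ∈ range p, if ((4 * k + 1 : ℕ) : ZMod p) = (x : ZMod p) ^ 2 then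
        ((4 * k + 1 : ℕ) : ℚ) / (4 * p) else 0 := by
  have e3 : ((x : ℚ) ^ 2 / (4 * (p : ℚ))) = ((x ^ 2 : ℕ) : ℚ) / ((4 * p : ℕ) : ℚ) := by
    push_cast; ring
  rw [e3, fract_nat_div]
  have hm : x ^ 2 % (4 * p) % 4 = 1 := by
    rw [Nat.mod_mul_right_mod]
    obtain ⟨m, rfl⟩ := hx
    have : (2 * m + 1) ^ 2 = 1 + 4 * (m ^ 2 + m) := by ring
    rw [this, Nat.add_mul_mod_self_left]
  have hlt : x ^ 2 % (4 * p) < 4 * p := Nat.mod_lt _ (by have := hodd.pos; omega)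
  obtain ⟨k, hk⟩ : ∃ k, x ^ 2 % (4 * p) = 4 * k + 1 := ⟨x ^ 2 % (4 * p) / 4, by omega⟩
  have hkp : k < p := by omega
  have hz : ((4 * k + 1 : ℕ) : ZMod p) = (x : ZMod p) ^ 2 := by
    rw [← hk, ← Nat.cast_pow, ZMod.natCast_eq_natCast_iff]
    exact (Nat.mod_modEq (x ^ 2) (4 * p)).of_mul_left 4
  rw [sum_eq_single_of_mem k (by simpa using hkp), if_pos hz, hk]
  · push_cast; ring
  · intro b hb hbk
    rw [if_neg]
    intro h
    exact hbk (four_inj p hodd b k (by simpa using hb) hkp (h.trans hz.symm))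

lemma ringChar_ne (p : ℕ) [Fact p.Prime] (hodd : Odd p) : ringChar (ZMod p) ≠ 2 := by
  rw [ZMod.ringChar_zmod_n]; rintro rfl; exact absurd hodd (by decide)

lemma sS_p_count (p : ℕ) [Fact p.Prime] (hodd : Odd p) :
    sS p = ∑ k ∈ range p, (1 + (legendreSym p ((4 * k + 1 : ℕ) : ℤ) : ℚ)) *
      (((4 * k + 1 : ℕ) : ℚ) / (4 * p)) := by
  have h1 : sS p = ∑ x ∈ range (2 * p), (if Odd x then
      (fun y : ZMod p => ∑ k ∈ range p, if ((4 * k + 1 : ℕ) : ZMod p) = y ^ 2 then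
        ((4 * k + 1 : ℕ) : ℚ) / (4 * p) else 0) (x : ZMod p) else 0) := by
    refine sum_congr rfl fun x _ => ?_
    rw [gG]
    split_ifs with h
    · exact fract_odd p hodd x h
    · rfl
  refine (h1.trans (sum_odd_zmod p hodd (fun y : ZMod p => ∑ k ∈ range p,
    if ((4 * k + 1 : ℕ) : ZMod p) = y ^ 2 then ((4 * k + 1 : ℕ) : ℚ) / (4 * p) else 0))).trans ?_
  rw [sum_comm]
  refine sum_congr rfl fun k _ => ?_
  have h2 := quadraticChar_card_sqrts (ringChar_ne p hodd) ((4 * k + 1 : ℕ) : ZMod p)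
  have h3 : (legendreSym p ((4 * k + 1 : ℕ) : ℤ)) =
    quadraticChar (ZMod p) ((4 * k + 1 : ℕ) : ZMod p) := by
    rw [legendreSym]; simp
  rw [h3, add_comm (1 : ℚ), show ((quadraticChar (ZMod p) ((4 * k + 1 : ℕ) : ZMod p) : ℤ) : ℚ) + 1
    = ((quadraticChar (ZMod p) ((4 * k + 1 : ℕ) : ZMod p) + 1 : ℤ) : ℚ) by push_cast; ring, ← h2]
  rw [← sum_filter, sum_const, nsmul_eq_mul]
  congr 1
  simp only [Int.cast_natCast]
  congr 2
  ext y
  simp [eq_comm]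

/-- Legendre as a rational function on naturals -/
def lL (p : ℕ) [Fact p.Prime] (a : ℕ) : ℚ := (legendreSym p (a : ℤ) : ℚ)

lemma lL_sum (p : ℕ) [Fact p.Prime] (hodd : Odd p) : ∑ a ∈ range p, lL p a = 0 := by
  have := sum_range_zmod p (fun y => ((quadraticChar (ZMod p) y : ℤ) : ℚ))
  rw [← Int.cast_sum univ, quadraticChar_sum_zero (ringChar_ne p hodd)] at this
  simpa [lL, legendreSym] using this

lemma lL_period (p : ℕ) [Fact p.Prime] (i j : ℕ) : lL p (i + p * j) = lL p i := by
  simp [lL, legendreSym]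

lemma lL_two (p : ℕ) [Fact p.Prime] (b : ℕ) : lL p (2 * b) = (legendreSym p 2 : ℚ) * lL p b := by
  simp [lL, legendreSym.mul]

lemma hStar_mul (p m : ℕ) [Fact p.Prime] (hodd : Odd p) (hm : 0 < m) :
    ∑ a ∈ range (p * m), lL p a * (a / (m * p)) = - hpStar p := by
  have hp0 : (p : ℚ) ≠ 0 := by exact_mod_cast hodd.pos.ne'
  have hm0 : (m : ℚ) ≠ 0 := by exact_mod_cast hm.ne'
  rw [sum_range_mul_aux]
  have h : ∀ j ∈ range m, ∑ i ∈ range p, lL p (i + p * j) * (((i + p * j : ℕ) : ℚ) / (m * p)) =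
      (- hpStar p) / m := by
    intro j _
    have : ∀ i ∈ range p, lL p (i + p * j) * (((i + p * j : ℕ) : ℚ) / (m * p)) =
      (lL p i * ((i : ℚ) / p)) / m + lL p i * (j / m) := by
      intro i _
      rw [lL_period]; push_cast; field_simp
    rw [sum_congr rfl this, sum_add_distrib, ← sum_mul, lL_sum p hodd, ← sum_div, hpStar, neg_neg]
    simp [lL]
  rw [sum_congr rfl h]; simp; field_simp

lemma t1_eval (p : ℕ) [Fact p.Prime] (hodd : Odd p) :
    ∑ k ∈ range p, lL p (4 * k + 1) * (((4 * k + 1 : ℕ) : ℚ) / (4 * p)) =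
      - ((1 - (legendreSym p 2 : ℚ)) * hpStar p + hpPrime p) / 2 := by
  set f : ℕ → ℚ := fun a => lL p a * ((a : ℚ) / (4 * p)) with hf
  have hall : ∑ a ∈ range (4 * p), f a = - hpStar p := by
    have := hStar_mul p 4 hodd (by norm_num)
    rw [mul_comm p 4] at this
    exact this
  have hev : ∑ b ∈ range (2 * p), f (2 * b) = - (legendreSym p 2 : ℚ) * hpStar p := by
    have := hStar_mul p 2 hodd (by norm_num)
    rw [mul_comm p 2] at this
    rw [neg_mul, ← mul_neg, ← this, mul_sum]
    refine sum_congr rfl fun b _ => ?_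
    simp only [hf, lL_two]
    push_cast
    ring
  have hpr : hpPrime p = - ∑ k ∈ range p, (f (1 + 4 * k) - f (3 + 4 * k)) := by
    rw [hpPrime, sum_filter, sum_range_mul_aux]
    congr 1
    refine sum_congr rfl fun k _ => ?_
    have e1 : (1 + 4 * k - 1) / 2 = 2 * k := by omega
    have e3 : (3 + 4 * k - 1) / 2 = 2 * k + 1 := by omega
    have o0 : ¬ Odd (0 + 4 * k) := by rw [Nat.odd_iff]; omega
    have o1 : Odd (1 + 4 * k) := by rw [Nat.odd_iff]; omega
    have o2 : ¬ Odd (2 + 4 * k) := by rw [Nat.odd_iff]; omega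
    have o3 : Odd (3 + 4 * k) := by rw [Nat.odd_iff]; omega
    rw [sum_range_succ, sum_range_succ, sum_range_succ, sum_range_one, if_neg o0, if_pos o1,
      if_neg o2, if_pos o3, e1, e3, pow_succ, pow_mul]
    simp only [hf, lL]
    norm_num
    ring
  have h4 : ∑ a ∈ range (4 * p), f a =
      ∑ k ∈ range p, (f (0 + 4 * k) + f (1 + 4 * k) + f (2 + 4 * k) + f (3 + 4 * k)) := by
    rw [sum_range_mul_aux]
    refine sum_congr rfl fun k _ => ?_
    rw [sum_range_succ, sum_range_succ, sum_range_succ, sum_range_one]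
  have h2 : ∑ b ∈ range (2 * p), f (2 * b) =
      ∑ k ∈ range p, (f (0 + 4 * k) + f (2 + 4 * k)) := by
    rw [sum_range_mul_aux]
    refine sum_congr rfl fun k _ => ?_
    rw [sum_range_succ, sum_range_one]
    congr 2 <;> ring
  have ht : ∑ k ∈ range p, lL p (4 * k + 1) * (((4 * k + 1 : ℕ) : ℚ) / (4 * p)) =
      ∑ k ∈ range p, f (1 + 4 * k) := by
    refine sum_congr rfl fun k _ => ?_
    rw [add_comm]
  rw [ht, hpr]
  simp only [sum_add_distrib, sum_sub_distrib] at *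
  linear_combination (hall - hev - h4 + h2) / 2

lemma sS_p_eval (p : ℕ) [Fact p.Prime] (hodd : Odd p) :
    sS p = ((p : ℚ) - 1) / 2 + 1 / 4
      - ((1 - (legendreSym p 2 : ℚ)) * hpStar p + hpPrime p) / 2 := by
  have hp0 : (p : ℚ) ≠ 0 := by exact_mod_cast hodd.pos.ne'
  have h := t1_eval p hodd
  have h2 : ∑ k ∈ range p, (((4 * k + 1 : ℕ) : ℚ) / (4 * p)) = ((p : ℚ) - 1) / 2 + 1 / 4 := by
    rw [← sum_div]
    push_cast
    rw [sum_add_distrib, ← mul_sum, sum_range_q]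
    simp
    field_simp
  rw [sS_p_count p hodd]
  simp only [add_mul, one_mul, sum_add_distrib]
  rw [h2]
  simp only [lL] at h
  rw [h]; ring

lemma fract_quarter (p : ℕ) (hodd : Odd p) :
    Int.fract ((p : ℚ) / 4) = 1 / 4 + (1 / 4) * (1 - (-1 : ℚ) ^ ((p - 1) / 2)) := by
  have := fract_nat_div p 4
  push_cast at this
  rw [this]
  have h2 := Nat.odd_iff.1 hodd
  obtain h | h : p % 4 = 1 ∨ p % 4 = 3 := by omega
  · rw [h, Even.neg_one_pow (by rw [Nat.even_iff]; omega)]; norm_num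
  · rw [h, Odd.neg_one_pow (by rw [Nat.odd_iff]; omega)]; norm_num

lemma fract_sq_step (p r : ℕ) (hodd : Odd p) :
    Int.fract ((p : ℚ) ^ (r + 2) / 4) = Int.fract ((p : ℚ) ^ r / 4) := by
  obtain ⟨m, rfl⟩ := hodd
  have : (((2 * m + 1 : ℕ) : ℚ) ^ (r + 2) / 4) = ((2 * m + 1 : ℕ) : ℚ) ^ r / 4 +
      (((2 * m + 1) ^ r * (m ^ 2 + m) : ℕ) : ℚ) := by
    push_cast; ring
  rw [this, Int.fract_add_natCast]

lemma main_aux (p : ℕ) [Fact p.Prime] (hodd : Odd p) (r : ℕ) :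
    sS (p ^ r) =
      (1 / 2) * ((p : ℚ) ^ r - (p : ℚ) ^ (r / 2)) +
        Int.fract ((p : ℚ) ^ r / 4) * (p : ℚ) ^ (r / 2) -
      (((p : ℚ) ^ ((r + 1) / 2) - 1) / (2 * ((p : ℚ) - 1))) *
        ((1 / 2) * (1 - (-1 : ℚ) ^ ((p - 1) / 2)) +
          (1 - (legendreSym p 2 : ℚ)) * hpStar p + hpPrime p) := by
  have hp1 : (p : ℚ) - 1 ≠ 0 := by
    have : (1 : ℚ) < p := by exact_mod_cast (Fact.out : p.Prime).one_lt
    linarith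
  have hS := sS_p_eval p hodd
  have hU := sS_p p hodd
  have hF := fract_quarter p hodd
  induction r using Nat.twoStepInduction with
  | zero =>
    have : Int.fract ((1 : ℚ) / 4) = 1 / 4 := by norm_num
    simp [sS, sum_range_succ, gG]
  | one =>
    simp only [pow_one, Nat.reduceDiv, Nat.reduceAdd, pow_zero]
    rw [hS, hF]
    field_simp
    ring
  | more r ih _ =>
    have h1 := sS_step p (p ^ r) hodd (pow_pos hodd.pos r)
    have e : p ^ r * p * p = p ^ (r + 1 + 1) := by ring
    rw [e, uU_pow p (r + 1) hodd, ih] at h1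
    have hu : uU p p = sS p - Int.fract ((p : ℚ) / 4) := by rw [hU]; ring
    rw [hu, hS, hF] at h1
    rw [show r + 2 = r + 1 + 1 from rfl, h1, fract_sq_step p r hodd,
      show (r + 1 + 1) / 2 = r / 2 + 1 by omega,
      show (r + 1 + 1 + 1) / 2 = (r + 1) / 2 + 1 by omega]
    field_simp
    ring

end aux

/-- For `p` an odd prime and `r ≥ 1`,
`∑_{0<x<2p^r, x odd} {x²/(4p^r)} = (1/2)(p^r - p^⌊r/2⌋) + {p^r/4}·p^⌊r/2⌋
  - ((p^⌊(r+1)/2⌋-1)/(2(p-1)))·((1/2)(1-(-1)^((p-1)/2)) + (1-(2|p))·h_p^* + h_p')`. -/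
theorem sum_fract_odd_sq_div_four_prime_pow (p : ℕ) [Fact p.Prime] (hodd : Odd p)
    (r : ℕ) (hr : 1 ≤ r) :
    ∑ x ∈ (Finset.range (2 * p ^ r)).filter (fun x => Odd x),
        Int.fract ((x : ℚ) ^ 2 / (4 * (p : ℚ) ^ r)) =
      (1 / 2) * ((p : ℚ) ^ r - (p : ℚ) ^ (r / 2)) +
        Int.fract ((p : ℚ) ^ r / 4) * (p : ℚ) ^ (r / 2) -
      (((p : ℚ) ^ ((r + 1) / 2) - 1) / (2 * ((p : ℚ) - 1))) *
        ((1 / 2) * (1 - (-1 : ℚ) ^ ((p - 1) / 2)) +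
          (1 - (legendreSym p 2 : ℚ)) * hpStar p + hpPrime p) := by
  have h := main_aux p hodd r
  rw [← h, sS, Finset.sum_filter]
  refine Finset.sum_congr rfl fun x _ => ?_
  simp only [gG, Nat.cast_pow]
end
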